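/- The system of three polynomial equations in three variables yz − (1/8 + 2x²) = 0, xy − (1/220 + x²) = 0, and z − (1 + x²) = 0 has exactly 4 solutions in ℂ³; each of these solutions is nondegenerate (the Jacobian determinant of the system is nonzero there), and each solution has all three coordinates real and strictly positive. -/

import Mathlib

open MvPolynomial

/-- The system `yz − (1/8 + 2x²) = xy − (1/220 + x²) = z − (1 + x²) = 0`. -/
noncomputable def sysThree : Fin 3 → MvPolynomial (Fin 3) ℂ :=
  ![X 1 * X 2 - (C (1 / 8 : ℂ) + 2 * (X 0) ^ 2),
    X 0 * X 1 - (C (1 / 220 : ℂ) + (X 0) ^ 2),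
    X 2 - (1 + (X 0) ^ 2)]

/-- The eliminant of `sysThree` in the first variable, scaled to have integer coefficients. -/
noncomputable def sysThreeEliminant : Polynomial ℂ :=
  Polynomial.C 440 * Polynomial.X ^ 4 + Polynomial.C (-880) * Polynomial.X ^ 3 +
    Polynomial.C 442 * Polynomial.X ^ 2 + Polynomial.C (-55) * Polynomial.X + Polynomial.C 2

theorem eval_sysThreeEliminant (a : ℂ) :
    sysThreeEliminant.eval a = 440 * a ^ 4 - 880 * a ^ 3 + 442 * a ^ 2 - 55 * a + 2 := by
  simp [sysThreeEliminant]
  ring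

theorem eval_derivative_sysThreeEliminant (a : ℂ) :
    sysThreeEliminant.derivative.eval a = 1760 * a ^ 3 - 2640 * a ^ 2 + 884 * a - 55 := by
  simp [sysThreeEliminant]
  ring

theorem natDegree_sysThreeEliminant : sysThreeEliminant.natDegree = 4 := by
  unfold sysThreeEliminant
  compute_degree!

theorem sysThreeEliminant_ne_zero : sysThreeEliminant ≠ 0 := by
  intro h
  simpa [h] using natDegree_sysThreeEliminant

/-- A polynomial with as many distinct roots as its degree has no other roots, and all its roots
are simple. -/
theorem Polynomial.isRoot_iff_mem_and_derivative_eval_ne_zero {R : Type*} [CommRing R] [IsDomain R]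
    {p : Polynomial R} (hp : p ≠ 0) {s : Finset R} (hs : ∀ a ∈ s, p.IsRoot a)
    (hcard : p.natDegree ≤ s.card) :
    (∀ a, p.IsRoot a ↔ a ∈ s) ∧ ∀ a ∈ s, p.derivative.eval a ≠ 0 := by
  classical
  have hroots : p.roots = s.val :=
    Polynomial.roots_eq_of_natDegree_le_card_of_ne_zero hs hcard hp
  refine ⟨fun a => by rw [← Polynomial.mem_roots hp, hroots, Finset.mem_val], fun a ha h => ?_⟩
  have h1 := (Polynomial.one_lt_rootMultiplicity_iff_isRoot hp).2 ⟨hs a ha, h⟩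
  rw [← Polynomial.count_roots, hroots] at h1
  exact absurd (Multiset.nodup_iff_count_le_one.1 s.nodup a) (not_le.2 h1)

theorem exists_positive_roots_sysThreeEliminant :
    ∃ s : Finset ℝ, s.card = 4 ∧ ∀ r ∈ s, 0 < r ∧ sysThreeEliminant.IsRoot (r : ℂ) := by
  let q : ℝ → ℝ := fun r => 440 * r ^ 4 - 880 * r ^ 3 + 442 * r ^ 2 - 55 * r + 2
  have hq : Continuous q := by fun_prop
  have hroot (r : ℝ) (h : q r = 0) : sysThreeEliminant.IsRoot (r : ℂ) := by
    rw [Polynomial.IsRoot, eval_sysThreeEliminant]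
    exact_mod_cast h
  obtain ⟨a, ⟨ha, ha'⟩, ha0⟩ := intermediate_value_Ioo' (a := 7 / 100) (b := 8 / 100)
    (by norm_num) hq.continuousOn (show (0 : ℝ) ∈ _ by constructor <;> norm_num [q])
  obtain ⟨b, ⟨hb, hb'⟩, hb0⟩ := intermediate_value_Ioo (a := 8 / 100) (b := 9 / 100)
    (by norm_num) hq.continuousOn (show (0 : ℝ) ∈ _ by constructor <;> norm_num [q])
  obtain ⟨c, ⟨hc, hc'⟩, hc0⟩ := intermediate_value_Ioo' (a := 1 / 2) (b := 1)
    (by norm_num) hq.continuousOn (show (0 : ℝ) ∈ _ by constructor <;> norm_num [q])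
  obtain ⟨d, ⟨hd, hd'⟩, hd0⟩ := intermediate_value_Ioo (a := 1) (b := 2)
    (by norm_num) hq.continuousOn (show (0 : ℝ) ∈ _ by constructor <;> norm_num [q])
  refine ⟨{a, b, c, d}, ?_, ?_⟩
  · have hab : a < b := by linarith
    have hbc : b < c := by linarith
    have hcd : c < d := by linarith
    have hac := hab.trans hbc
    have hbd := hbc.trans hcd
    simp [hab.ne, hac.ne, (hac.trans hcd).ne, hbc.ne, hbd.ne, hcd.ne]
  · simp only [Finset.mem_insert, Finset.mem_singleton]
    rintro r (rfl | rfl | rfl | rfl)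
    · exact ⟨by linarith, hroot _ ha0⟩
    · exact ⟨by linarith, hroot _ hb0⟩
    · exact ⟨by linarith, hroot _ hc0⟩
    · exact ⟨by linarith, hroot _ hd0⟩

theorem sysThree_eval_eq_zero_iff (x : Fin 3 → ℂ) :
    (∀ i, MvPolynomial.eval x (sysThree i) = 0) ↔
      sysThreeEliminant.IsRoot (x 0) ∧
        x = ![x 0, (1 / 220 + x 0 ^ 2) / x 0, 1 + x 0 ^ 2] := by
  rw [Polynomial.IsRoot, eval_sysThreeEliminant]
  simp only [Fin.forall_fin_succ, funext_iff]
  simp [sysThree]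
  constructor
  · rintro ⟨h1, h2, h3⟩
    have h0 : x 0 ≠ 0 := by
      intro h
      norm_num [h] at h2
    refine ⟨?_, ?_, by linear_combination h3⟩
    · linear_combination 440 * x 0 * h1 - 440 * x 2 * h2 - (2 + 440 * x 0 ^ 2) * h3
    · field_simp
      linear_combination 220 * h2
  · rintro ⟨h, h1, h2⟩
    have h0 : x 0 ≠ 0 := by
      intro h0
      norm_num [h0] at h
    rw [h1, h2]
    refine ⟨?_, ?_, by ring⟩
    · field_simp
      linear_combination 4 * h
    · field_simp
      ring

theorem det_jacobian_sysThree {x : Fin 3 → ℂ} (hx : ∀ i, MvPolynomial.eval x (sysThree i) = 0) :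
    440 * (Matrix.of fun i j => MvPolynomial.eval x (MvPolynomial.pderiv j (sysThree i))).det =
      sysThreeEliminant.derivative.eval (x 0) := by
  have h1 := hx 0
  have h2 := hx 1
  have h3 := hx 2
  simp [sysThree] at h1 h2 h3
  rw [eval_derivative_sysThreeEliminant, Matrix.det_fin_three]
  have htwo (i : Fin 3) : pderiv i (2 : MvPolynomial (Fin 3) ℂ) = 0 := by
    exact_mod_cast (pderiv i : Derivation ℂ _ (MvPolynomial (Fin 3) ℂ)).map_natCast 2
  simp [sysThree, htwo, MvPolynomial.pderiv_X, Derivation.leibniz_pow]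
  linear_combination -440 * h1 + 880 * x 0 * h2 + 880 * x 0 * h3

/-- The system `yz − (1/8 + 2x²) = 0`, `xy − (1/220 + x²) = 0`,
`z − (1 + x²) = 0` has exactly `4` solutions in `ℂ³`; each solution is nondegenerate
(the Jacobian determinant is nonzero there) and has all three coordinates real and
strictly positive. -/
theorem sysThree_count :
    ∃ S : Finset (Fin 3 → ℂ),
      (∀ x : Fin 3 → ℂ, x ∈ S ↔ ∀ i, MvPolynomial.eval x (sysThree i) = 0) ∧
      S.card = 4 ∧
      ∀ x ∈ S,
        (Matrix.of fun i j => MvPolynomial.eval x (MvPolynomial.pderiv j (sysThree i))).det ≠ 0 ∧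
        ∀ i, (x i).im = 0 ∧ 0 < (x i).re := by
  classical
  obtain ⟨s, hcard, hs⟩ := exists_positive_roots_sysThreeEliminant
  let t : Finset ℂ := s.image (fun r : ℝ => (r : ℂ))
  have htcard : t.card = 4 := by
    rw [Finset.card_image_of_injective _ Complex.ofReal_injective, hcard]
  have ht : ∀ a ∈ t, sysThreeEliminant.IsRoot a := by
    intro a ha
    obtain ⟨r, hr, rfl⟩ := Finset.mem_image.1 ha
    exact (hs r hr).2
  obtain ⟨hroot, hder⟩ := Polynomial.isRoot_iff_mem_and_derivative_eval_ne_zero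
    sysThreeEliminant_ne_zero ht (by rw [natDegree_sysThreeEliminant, htcard])
  let f : ℂ → Fin 3 → ℂ := fun a => ![a, (1 / 220 + a ^ 2) / a, 1 + a ^ 2]
  have hf : Function.Injective f := fun a b h => congrFun h 0
  have hmem (x : Fin 3 → ℂ) :
      x ∈ t.image f ↔ ∀ i, MvPolynomial.eval x (sysThree i) = 0 := by
    rw [sysThree_eval_eq_zero_iff, hroot, Finset.mem_image]
    constructor
    · rintro ⟨a, ha, rfl⟩
      exact ⟨ha, rfl⟩
    · rintro ⟨ha, h⟩
      exact ⟨x 0, ha, h.symm⟩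
  refine ⟨t.image f, hmem, by rw [Finset.card_image_of_injective _ hf, htcard], ?_⟩
  intro x hx
  constructor
  · intro h
    have hdet := det_jacobian_sysThree ((hmem x).1 hx)
    rw [h, mul_zero] at hdet
    obtain ⟨a, ha, rfl⟩ := Finset.mem_image.1 hx
    exact hder a ha hdet.symm
  · obtain ⟨a, ha, rfl⟩ := Finset.mem_image.1 hx
    obtain ⟨r, hr, rfl⟩ := Finset.mem_image.1 ha
    have hpos := (hs r hr).1
    have hreal : ∀ i, f r i = ((![r, (1 / 220 + r ^ 2) / r, 1 + r ^ 2] i : ℝ) : ℂ) := by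
      intro i
      fin_cases i <;> simp [f]
    intro i
    rw [hreal, Complex.ofReal_im, Complex.ofReal_re]
    refine ⟨rfl, ?_⟩
    fin_cases i <;> simp <;> positivity
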